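/- arXiv:1507.02775 — 2 statements merged into one kernel-verified Lean document; each statement's English description precedes it below -/
import Mathlib

section
/- (Theorem 1.1, Dirichlet case: the new formula for the bulk energy.) Let b > 0, E < 0 a real number and C₀ ≥ 0. Assume that for every R > 1: (i) E_blk(v; b, R) ≥ R²E for every v in the Dirichlet class D_R; and (ii) there exists u_R ∈ D_R, C² on Q_R, satisfying −b(∇−iA₀)²u_R = (1 − |u_R|²)u_R in Q_R and E_blk(u_R; b, R) ≤ R²E + C₀R. Define m^D(b,R) = inf{ E_lin(v;b,R)/(∫_{Q_R}|v|⁴)^{1/2} : v ∈ D_R, v ≠ 0 }. Then lim_{R→∞} m^D(b,R)/R = −√(−2E); equivalently, E = −(1/2)·(lim_{R→∞} m^D(b,R)/R)². -/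
open MeasureTheory

noncomputable section

/-- The vector potential `A₀(x₁,x₂) = (−x₂/2, x₁/2)`, generating a unit magnetic field. -/
def A0 (x : ℝ × ℝ) : ℝ × ℝ := (-x.2 / 2, x.1 / 2)

/-- `|(∇−iA₀)u|²`, the squared modulus of the magnetic gradient of `u`. -/
def magGradSq (u : ℝ × ℝ → ℂ) (x : ℝ × ℝ) : ℝ :=
  ‖fderiv ℝ u x (1, 0) - Complex.I * ((A0 x).1 : ℂ) * u x‖ ^ 2 +
  ‖fderiv ℝ u x (0, 1) - Complex.I * ((A0 x).2 : ℂ) * u x‖ ^ 2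

/-- The open square `Q_R = (−R/2,R/2) × (−R/2,R/2)`. -/
def QR (R : ℝ) : Set (ℝ × ℝ) := Set.Ioo (-R / 2) (R / 2) ×ˢ Set.Ioo (-R / 2) (R / 2)

/-- The bulk energy `E_blk(u;b,R) = ∫_{Q_R} (b|(∇−iA₀)u|² − |u|² + ½|u|⁴)`. -/
def Eblk (u : ℝ × ℝ → ℂ) (b R : ℝ) : ℝ :=
  ∫ x in QR R, (b * magGradSq u x - ‖u x‖ ^ 2 + (1 / 2) * ‖u x‖ ^ 4)

/-- The linear energy `E_lin(u;b,R) = ∫_{Q_R} (b|(∇−iA₀)u|² − |u|²)`. -/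
def Elin (u : ℝ × ℝ → ℂ) (b R : ℝ) : ℝ :=
  ∫ x in QR R, (b * magGradSq u x - ‖u x‖ ^ 2)

/-- The Dirichlet class `D_R`: functions `C¹` on the closure of `Q_R` vanishing on `∂Q_R`. -/
def DirichletClass (u : ℝ × ℝ → ℂ) (R : ℝ) : Prop :=
  ContDiffOn ℝ 1 u (closure (QR R)) ∧ ∀ x ∈ frontier (QR R), u x = 0

/-- The Neumann class `N_R`: functions `C¹` on the closure of `Q_R`. -/
def NeumannClass (u : ℝ × ℝ → ℂ) (R : ℝ) : Prop :=
  ContDiffOn ℝ 1 u (closure (QR R))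

/-- The magnetic Laplacian `(∇−iA₀)²u = Δu − 2i A₀·∇u − |A₀|²u` (using `div A₀ = 0`). -/
def magLap (u : ℝ × ℝ → ℂ) (x : ℝ × ℝ) : ℂ :=
  (fderiv ℝ (fun y => fderiv ℝ u y (1, 0)) x (1, 0) +
   fderiv ℝ (fun y => fderiv ℝ u y (0, 1)) x (0, 1))
  - 2 * Complex.I * (((A0 x).1 : ℂ) * fderiv ℝ u x (1, 0) +
                     ((A0 x).2 : ℂ) * fderiv ℝ u x (0, 1))
  - (((A0 x).1 ^ 2 + (A0 x).2 ^ 2 : ℝ) : ℂ) * u x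

/-- The constrained Dirichlet ground-state energy
`m^D(b,R) = inf { E_lin(u;b,R) / (∫_{Q_R}|u|⁴)^{1/2} : u ∈ D_R, u ≠ 0 }`. -/
def mD (b R : ℝ) : ℝ :=
  sInf {m : ℝ | ∃ u : ℝ × ℝ → ℂ, DirichletClass u R ∧ u ≠ 0 ∧
    m = Elin u b R / Real.sqrt (∫ x in QR R, ‖u x‖ ^ 4)}

/-- The constrained Neumann ground-state energy
`m^N(b,R) = inf { E_lin(u;b,R) / (∫_{Q_R}|u|⁴)^{1/2} : u ∈ N_R, u ≠ 0 }`. -/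
def mN (b R : ℝ) : ℝ :=
  sInf {m : ℝ | ∃ u : ℝ × ℝ → ℂ, NeumannClass u R ∧ u ≠ 0 ∧
    m = Elin u b R / Real.sqrt (∫ x in QR R, ‖u x‖ ^ 4)}

/-- The outward unit normal of the square `Q_R` (at non-corner boundary points). -/
def nuSq (R : ℝ) (x : ℝ × ℝ) : ℝ × ℝ :=
  (if x.1 = R / 2 then 1 else if x.1 = -R / 2 then -1 else 0,
   if x.2 = R / 2 then 1 else if x.2 = -R / 2 then -1 else 0)

/-- The corner points of the square `Q_R`. -/
def IsCornerPt (R : ℝ) (x : ℝ × ℝ) : Prop :=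
  (x.1 = R / 2 ∨ x.1 = -R / 2) ∧ (x.2 = R / 2 ∨ x.2 = -R / 2)

/-- The magnetic Neumann boundary condition `ν·(∇−iA₀)u = 0` at non-corner points of `∂Q_R`. -/
def MagNeumannBC (u : ℝ × ℝ → ℂ) (R : ℝ) : Prop :=
  ∀ x ∈ frontier (QR R), ¬ IsCornerPt R x →
    ((nuSq R x).1 : ℂ) * (fderiv ℝ u x (1, 0) - Complex.I * ((A0 x).1 : ℂ) * u x) +
    ((nuSq R x).2 : ℂ) * (fderiv ℝ u x (0, 1) - Complex.I * ((A0 x).2 : ℂ) * u x) = 0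

/-- The fourth power of a function of the Dirichlet class is integrable on the square. -/
lemma DirichletClass.integrableOn_norm_pow_four {u : ℝ × ℝ → ℂ} {R : ℝ}
    (hu : DirichletClass u R) : IntegrableOn (fun x => ‖u x‖ ^ 4) (QR R) := by
  have hbdd : Bornology.IsBounded (QR R) :=
    Bornology.IsBounded.prod (Metric.isBounded_Ioo _ _) (Metric.isBounded_Ioo _ _)
  exact ((hu.1.continuousOn.norm.pow 4).integrableOn_compact hbdd.isCompact_closure).mono_set
    subset_closure

lemma DirichletClass.const_smul {u : ℝ × ℝ → ℂ} {R : ℝ} (hu : DirichletClass u R) (t : ℝ) :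
    DirichletClass (t • u) R :=
  ⟨hu.1.const_smul t, fun x hx => by simp [hu.2 x hx]⟩

lemma magGradSq_nonneg (u : ℝ × ℝ → ℂ) (x : ℝ × ℝ) : 0 ≤ magGradSq u x := by
  unfold magGradSq
  positivity

lemma magGradSq_const_smul (t : ℝ) (u : ℝ × ℝ → ℂ) (x : ℝ × ℝ) :
    magGradSq (t • u) x = t ^ 2 * magGradSq u x := by
  have key : ∀ w a : ℂ, ‖t • w - a * (t • u x)‖ ^ 2 = t ^ 2 * ‖w - a * u x‖ ^ 2 := by
    intro w a
    rw [mul_smul_comm, ← smul_sub, norm_smul, mul_pow, Real.norm_eq_abs, sq_abs]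
  simp only [magGradSq, fderiv_const_smul_field, Pi.smul_apply, smul_apply,
    key]
  ring

/-- The bulk energy splits into the linear energy and the quartic term. -/
lemma Eblk_eq_Elin_add {u : ℝ × ℝ → ℂ} {b R : ℝ} (hu : DirichletClass u R)
    (hint : IntegrableOn (fun x => b * magGradSq u x - ‖u x‖ ^ 2) (QR R)) :
    Eblk u b R = Elin u b R + 1 / 2 * ∫ x in QR R, ‖u x‖ ^ 4 := by
  rw [Eblk, Elin, integral_add hint (hu.integrableOn_norm_pow_four.const_mul _),
    integral_const_mul]

lemma Elin_const_smul (t : ℝ) (u : ℝ × ℝ → ℂ) (b R : ℝ) :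
    Elin (t • u) b R = t ^ 2 * Elin u b R := by
  rw [Elin, Elin, ← integral_const_mul]
  congr 1 with x
  rw [magGradSq_const_smul, Pi.smul_apply, norm_smul, mul_pow, Real.norm_eq_abs, sq_abs]
  ring

lemma integral_norm_const_smul_pow_four (t : ℝ) (u : ℝ × ℝ → ℂ) (R : ℝ) :
    ∫ x in QR R, ‖(t • u) x‖ ^ 4 = t ^ 4 * ∫ x in QR R, ‖u x‖ ^ 4 := by
  rw [← integral_const_mul]
  congr 1 with x
  rw [Pi.smul_apply, norm_smul, mul_pow, Real.norm_eq_abs, Even.pow_abs (by decide)]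

/-- If the bulk energy is at least `-K` on all real multiples of `v`, then the quotient of the linear
energy by the `L⁴` norm is at least `-√(2K)`. -/
lemma neg_sqrt_le_Elin_div {v : ℝ × ℝ → ℂ} {b R K : ℝ} (hv : DirichletClass v R)
    (hlow : ∀ t : ℝ, -K ≤ Eblk (t • v) b R) :
    -√(2 * K) ≤ Elin v b R / √(∫ x in QR R, ‖v x‖ ^ 4) := by
  set N := ∫ x in QR R, ‖v x‖ ^ 4
  have hN0 : 0 ≤ N := integral_nonneg fun x => by positivity
  rcases le_or_gt 0 (Elin v b R) with hL | hL
  · exact (neg_nonpos.2 (Real.sqrt_nonneg _)).trans (by positivity)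
  rcases hN0.eq_or_lt with hN0 | hNpos
  · simp [← hN0]
  have hint : IntegrableOn (fun x => b * magGradSq v x - ‖v x‖ ^ 2) (QR R) := by
    by_contra h
    exact hL.ne (integral_undef h)
  have hscale : ∀ t : ℝ, Eblk (t • v) b R = t ^ 2 * Elin v b R + 1 / 2 * (t ^ 4 * N) := by
    intro t
    rw [Eblk_eq_Elin_add (hv.const_smul t), Elin_const_smul, integral_norm_const_smul_pow_four]
    refine (hint.const_mul (t ^ 2)).congr (.of_forall fun x => ?_)
    simp only
    rw [magGradSq_const_smul, Pi.smul_apply, norm_smul, mul_pow, Real.norm_eq_abs, sq_abs]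
    ring
  have hopt := hlow √(-Elin v b R / N)
  have ht : √(-Elin v b R / N) ^ 2 = -Elin v b R / N :=
    Real.sq_sqrt (div_nonneg (by linarith) hNpos.le)
  rw [hscale, show √(-Elin v b R / N) ^ 4 = (√(-Elin v b R / N) ^ 2) ^ 2 by ring, ht] at hopt
  have hsq : (Elin v b R) ^ 2 / N ≤ 2 * K := by
    have : -Elin v b R / N * Elin v b R + 1 / 2 * ((-Elin v b R / N) ^ 2 * N)
        = -((Elin v b R) ^ 2 / N) / 2 := by
      field_simp
      ring
    linarith
  rw [neg_le, ← neg_div]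
  apply Real.le_sqrt_of_sq_le
  rwa [div_pow, Real.sq_sqrt hNpos.le, neg_sq]

/-- A function of the Dirichlet class with negative bulk energy does not vanish almost everywhere
on the square. -/
lemma integral_norm_pow_four_pos {u : ℝ × ℝ → ℂ} {b R : ℝ} (hb : 0 ≤ b)
    (hu : DirichletClass u R) (hneg : Eblk u b R < 0) : 0 < ∫ x in QR R, ‖u x‖ ^ 4 := by
  refine (integral_nonneg fun x => by positivity).lt_of_ne' fun h0 => hneg.not_ge ?_
  rw [integral_eq_zero_iff_of_nonneg (fun x => by positivity) hu.integrableOn_norm_pow_four] at h0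
  refine integral_nonneg_of_ae ?_
  filter_upwards [h0] with x hx
  have hux : ‖u x‖ = 0 := by simpa using hx
  simpa [hux] using mul_nonneg hb (magGradSq_nonneg u x)

/-- If the bulk energy of `u` is at most `-K < 0`, then the quotient of the linear energy by the
`L⁴` norm is at most `-√(2K)`. -/
lemma Elin_div_le_neg_sqrt {u : ℝ × ℝ → ℂ} {b R K : ℝ} (hb : 0 ≤ b) (hK : 0 < K)
    (hu : DirichletClass u R) (hle : Eblk u b R ≤ -K) :
    Elin u b R / √(∫ x in QR R, ‖u x‖ ^ 4) ≤ -√(2 * K) := by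
  have hneg : Eblk u b R < 0 := by linarith
  have hNpos := integral_norm_pow_four_pos hb hu hneg
  have hint : IntegrableOn (fun x => b * magGradSq u x - ‖u x‖ ^ 2) (QR R) := by
    by_contra h
    refine hneg.ne (integral_undef fun h' => h ?_)
    exact (h'.sub (hu.integrableOn_norm_pow_four.const_mul (1 / 2))).congr
      (.of_forall fun x => add_sub_cancel_right _ _)
  rw [Eblk_eq_Elin_add hu hint] at hle
  set N := ∫ x in QR R, ‖u x‖ ^ 4
  have hs := Real.sq_sqrt hNpos.le
  have hk := Real.sq_sqrt (show 0 ≤ 2 * K by positivity)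
  rw [div_le_iff₀ (Real.sqrt_pos.2 hNpos)]
  nlinarith [sq_nonneg (√N - √(2 * K))]

/-- Theorem 1.1, Dirichlet case: the new formula for the bulk energy,
`lim_{R→∞} m^D(b,R)/R = −√(−2E)`, equivalently `E = −½(lim_{R→∞} m^D(b,R)/R)²`. -/
theorem new_formula_dirichlet (b E C₀ : ℝ) (hb : 0 < b) (hE : E < 0) (hC₀ : 0 ≤ C₀)
    (hlow : ∀ R : ℝ, 1 < R → ∀ v : ℝ × ℝ → ℂ, DirichletClass v R →
      Eblk v b R ≥ R ^ 2 * E)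
    (hex : ∀ R : ℝ, 1 < R → ∃ u : ℝ × ℝ → ℂ, DirichletClass u R ∧
      ContDiffOn ℝ 2 u (QR R) ∧
      (∀ x ∈ QR R, -(b : ℂ) * magLap u x = ((1 - ‖u x‖ ^ 2 : ℝ) : ℂ) * u x) ∧
      Eblk u b R ≤ R ^ 2 * E + C₀ * R) :
    Filter.Tendsto (fun R : ℝ => mD b R / R) Filter.atTop
      (nhds (-Real.sqrt (-2 * E))) ∧
    E = -(1 / 2) * (-Real.sqrt (-2 * E)) ^ 2 := by
  have hlower : ∀ R : ℝ, 1 < R → ∀ v, DirichletClass v R →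
      -√(-2 * E) * R ≤ Elin v b R / √(∫ x in QR R, ‖v x‖ ^ 4) := by
    intro R hR v hv
    have h := neg_sqrt_le_Elin_div (b := b) (K := -(R ^ 2 * E)) hv fun t => by
      simpa using hlow R hR _ (hv.const_smul t)
    rwa [show 2 * -(R ^ 2 * E) = -2 * E * R ^ 2 by ring, Real.sqrt_mul (by linarith),
      Real.sqrt_sq (by linarith), ← neg_mul] at h
  have hbelow : ∀ R : ℝ, 1 < R → ∀ m ∈ {m : ℝ | ∃ u : ℝ × ℝ → ℂ, DirichletClass u R ∧ u ≠ 0 ∧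
      m = Elin u b R / Real.sqrt (∫ x in QR R, ‖u x‖ ^ 4)}, -√(-2 * E) * R ≤ m := by
    rintro R hR m ⟨u, hu, -, rfl⟩
    exact hlower R hR u hu
  have hlim : Filter.Tendsto (fun R : ℝ => -√(-2 * E - 2 * C₀ / R)) Filter.atTop
      (nhds (-√(-2 * E))) := by
    have h : Filter.Tendsto (fun R : ℝ => -2 * E - 2 * C₀ / R) Filter.atTop
        (nhds (-2 * E - 0)) :=
      tendsto_const_nhds.sub (tendsto_const_nhds.div_atTop Filter.tendsto_id)
    rw [sub_zero] at h
    exact ((Real.continuous_sqrt.tendsto _).comp h).neg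
  have hupper : ∀ R : ℝ, 1 < R → C₀ / -E < R →
      mD b R ≤ -√(-2 * E - 2 * C₀ / R) * R ∧ -√(-2 * E) * R ≤ mD b R := by
    intro R hR hCR
    have hR0 : 0 < R := by linarith
    obtain ⟨u, hu, -, -, hle⟩ := hex R hR
    have hK : 0 < -(R ^ 2 * E + C₀ * R) := by
      rw [div_lt_iff₀ (by linarith)] at hCR
      nlinarith
    have hNpos := integral_norm_pow_four_pos hb.le hu (by linarith)
    have hu0 : u ≠ 0 := by
      rintro rfl
      simp at hNpos
    have h := Elin_div_le_neg_sqrt hb.le hK hu (by linarith)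
    rw [show 2 * -(R ^ 2 * E + C₀ * R) = (-2 * E - 2 * C₀ / R) * R ^ 2 by field_simp; ring,
      Real.sqrt_mul' _ (sq_nonneg R), Real.sqrt_sq hR0.le, ← neg_mul] at h
    exact ⟨(csInf_le ⟨_, hbelow R hR⟩ ⟨u, hu, hu0, rfl⟩).trans h,
      le_csInf ⟨_, u, hu, hu0, rfl⟩ (hbelow R hR)⟩
  refine ⟨tendsto_of_tendsto_of_tendsto_of_le_of_le' tendsto_const_nhds hlim ?_ ?_, ?_⟩
  · filter_upwards [Filter.eventually_gt_atTop 1, Filter.eventually_gt_atTop (C₀ / -E)]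
      with R hR hCR
    rw [le_div_iff₀ (by linarith)]
    exact (hupper R hR hCR).2
  · filter_upwards [Filter.eventually_gt_atTop 1, Filter.eventually_gt_atTop (C₀ / -E)]
      with R hR hCR
    rw [div_le_iff₀ (by linarith)]
    exact (hupper R hR hCR).1
  · rw [neg_sq, Real.sq_sqrt (by linarith)]
    ring
end
end

section
/- (Upper bound of Theorem 1.1, Neumann case, quantitative per-R form.) Let b > 0, R > 0, E < 0 a real number and C₀ ≥ 0 with R > C₀/(−E). Suppose u belongs to the Neumann class N_R, is C² on Q_R, satisfies −b(∇−iA₀)²u = (1 − |u|²)u in Q_R, satisfies the magnetic Neumann boundary condition ν(x)·(∇u(x) − iA₀(x)u(x)) = 0 at every non-corner point x of ∂Q_R (ν the outward unit normal), and E_blk(u; b, R) ≤ R²E + C₀R. Then ∫_{Q_R}|u|⁴ dx > 0 and E_lin(u; b, R) ≤ (−R·√(−2E) + 2C₀·(−2E)^{−1/2})·(∫_{Q_R}|u|⁴ dx)^{1/2}. In particular m^N(b,R) = inf{ E_lin(v;b,R)/(∫_{Q_R}|v|⁴)^{1/2} : v ∈ N_R, v ≠ 0 } satisfies m^N(b,R)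 ≤ −R√(−2E) + 2C₀(−2E)^{−1/2}. -/
open MeasureTheory

noncomputable section

open Set in
/-- The closure of the square `Q_R` is the closed square. -/
lemma closure_QR {R : ℝ} (hR : 0 < R) :
    closure (QR R) = Icc (-R / 2, -R / 2) (R / 2, R / 2) := by
  have h : -R / 2 ≠ R / 2 := by intro h; linarith
  rw [QR, closure_prod_eq, closure_Ioo h, Icc_prod_Icc]

lemma isOpen_QR (R : ℝ) : IsOpen (QR R) := isOpen_Ioo.prod isOpen_Ioo

lemma closure_QR_mem_nhds {R : ℝ} {x : ℝ × ℝ} (hx : x ∈ QR R) : closure (QR R) ∈ nhds x :=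
  Filter.mem_of_superset ((isOpen_QR R).mem_nhds hx) subset_closure

lemma isCompact_closure_QR {R : ℝ} (hR : 0 < R) : IsCompact (closure (QR R)) := by
  rw [closure_QR hR]; exact isCompact_Icc

lemma QR_ae_eq_closure {R : ℝ} (hR : 0 < R) : QR R =ᵐ[volume] closure (QR R) := by
  rw [closure_QR hR, QR, ← Set.Icc_prod_Icc]
  exact Measure.set_prod_ae_eq Ioo_ae_eq_Icc Ioo_ae_eq_Icc

lemma volume_real_QR {R : ℝ} (hR : 0 < R) : (volume : Measure (ℝ × ℝ)).real (QR R) = R ^ 2 := by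
  have h : R / 2 - -R / 2 = R := by ring
  rw [QR, Measure.volume_eq_prod, measureReal_prod_prod, Real.volume_real_Ioo_of_le (by linarith),
    h, sq]

lemma uniqueDiffOn_closure_QR {R : ℝ} (hR : 0 < R) : UniqueDiffOn ℝ (closure (QR R)) := by
  rw [closure_QR hR, ← Set.Icc_prod_Icc]
  exact (uniqueDiffOn_Icc (by linarith)).prod (uniqueDiffOn_Icc (by linarith))

/-- A function that agrees on `Q_R` with a function continuous on the closed square is integrable
on `Q_R`. -/
lemma integrableOn_QR_of_eqOn {F : Type*} [NormedAddCommGroup F] {R : ℝ} (hR : 0 < R)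
    {f g : ℝ × ℝ → F}
    (hg : ContinuousOn g (closure (QR R))) (hfg : Set.EqOn f g (QR R)) :
    IntegrableOn f (QR R) :=
  ((hg.integrableOn_compact (isCompact_closure_QR hR)).mono_set subset_closure).congr_fun
    hfg.symm (isOpen_QR R).measurableSet

lemma fderivWithin_closure_QR (u : ℝ × ℝ → ℂ) {R : ℝ} {x : ℝ × ℝ} (hx : x ∈ QR R) :
    fderivWithin ℝ u (closure (QR R)) x = fderiv ℝ u x :=
  fderivWithin_of_mem_nhds (closure_QR_mem_nhds hx)

lemma NeumannClass.continuousOn {u : ℝ × ℝ → ℂ} {R : ℝ} (hu : NeumannClass u R) :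
    ContinuousOn u (closure (QR R)) :=
  ContDiffOn.continuousOn hu

/-- The first derivatives of a function of the Neumann class extend continuously to the closed
square. -/
lemma NeumannClass.continuousOn_fderivWithin_apply {u : ℝ × ℝ → ℂ} {R : ℝ} (hR : 0 < R)
    (hu : NeumannClass u R) (v : ℝ × ℝ) :
    ContinuousOn (fun x => fderivWithin ℝ u (closure (QR R)) x v) (closure (QR R)) :=
  (ContDiffOn.continuousOn_fderivWithin hu (uniqueDiffOn_closure_QR hR) le_rfl).clm_apply
    continuousOn_const

lemma continuous_A0 : Continuous A0 := by unfold A0; fun_prop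

lemma NeumannClass.integrableOn_magGradSq {u : ℝ × ℝ → ℂ} {R : ℝ} (hR : 0 < R)
    (hu : NeumannClass u R) : IntegrableOn (magGradSq u) (QR R) := by
  have h₁ := hu.continuousOn_fderivWithin_apply hR (1, 0)
  have h₂ := hu.continuousOn_fderivWithin_apply hR (0, 1)
  have h₀ := hu.continuousOn
  have hA := continuous_A0.continuousOn (s := closure (QR R))
  refine integrableOn_QR_of_eqOn hR
    (g := fun x => ‖fderivWithin ℝ u (closure (QR R)) x (1, 0) -
        Complex.I * ((A0 x).1 : ℂ) * u x‖ ^ 2 +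
      ‖fderivWithin ℝ u (closure (QR R)) x (0, 1) -
        Complex.I * ((A0 x).2 : ℂ) * u x‖ ^ 2) ?_ ?_
  · have hA₁ : ContinuousOn (fun x => ((A0 x).1 : ℂ)) (closure (QR R)) :=
      Complex.continuous_ofReal.comp_continuousOn hA.fst
    have hA₂ : ContinuousOn (fun x => ((A0 x).2 : ℂ)) (closure (QR R)) :=
      Complex.continuous_ofReal.comp_continuousOn hA.snd
    fun_prop
  · intro x hx
    simp only [magGradSq, fderivWithin_closure_QR u hx]

lemma NeumannClass.integrableOn_norm_pow {u : ℝ × ℝ → ℂ} {R : ℝ} (hR : 0 < R)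
    (hu : NeumannClass u R) (n : ℕ) : IntegrableOn (fun x => ‖u x‖ ^ n) (QR R) :=
  integrableOn_QR_of_eqOn hR (hu.continuousOn.norm.pow n) fun _ _ => rfl

lemma NeumannClass.Elin_eq {u : ℝ × ℝ → ℂ} {R : ℝ} (hR : 0 < R) (hu : NeumannClass u R) (b : ℝ) :
    Elin u b R = b * (∫ x in QR R, magGradSq u x) - ∫ x in QR R, ‖u x‖ ^ 2 := by
  rw [Elin, integral_sub ((hu.integrableOn_magGradSq hR).const_mul b)
    (hu.integrableOn_norm_pow hR 2), integral_const_mul]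

lemma NeumannClass.Eblk_eq {u : ℝ × ℝ → ℂ} {R : ℝ} (hR : 0 < R) (hu : NeumannClass u R) (b : ℝ) :
    Eblk u b R = Elin u b R + 1 / 2 * ∫ x in QR R, ‖u x‖ ^ 4 := by
  have h : IntegrableOn (fun x => b * magGradSq u x - ‖u x‖ ^ 2) (QR R) :=
    ((hu.integrableOn_magGradSq hR).const_mul b).sub (hu.integrableOn_norm_pow hR 2)
  rw [Eblk, Elin, integral_add h ((hu.integrableOn_norm_pow hR 4).const_mul _),
    integral_const_mul]

/-- The Cauchy–Schwarz inequality `∫_{Q_R} |u|² ≤ R (∫_{Q_R} |u|⁴)^{1/2}`. -/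
lemma NeumannClass.integral_norm_sq_le {u : ℝ × ℝ → ℂ} {R : ℝ} (hR : 0 < R)
    (hu : NeumannClass u R) :
    ∫ x in QR R, ‖u x‖ ^ 2 ≤ R * Real.sqrt (∫ x in QR R, ‖u x‖ ^ 4) := by
  set M := ∫ x in QR R, ‖u x‖ ^ 2
  set P := ∫ x in QR R, ‖u x‖ ^ 4
  have h₂ := hu.integrableOn_norm_pow hR 2
  have h₄ := hu.integrableOn_norm_pow hR 4
  have hc : IntegrableOn (fun _ : ℝ × ℝ => (M / R ^ 2) ^ 2) (QR R) :=
    integrableOn_QR_of_eqOn hR continuousOn_const fun _ _ => rfl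
  have hexp : ∫ x in QR R, (‖u x‖ ^ 2 - M / R ^ 2) ^ 2 =
      P - 2 * (M / R ^ 2) * M + R ^ 2 * (M / R ^ 2) ^ 2 := by
    have hpt : ∀ x, (‖u x‖ ^ 2 - M / R ^ 2) ^ 2 =
        ‖u x‖ ^ 4 - 2 * (M / R ^ 2) * ‖u x‖ ^ 2 + (M / R ^ 2) ^ 2 := fun x => by ring
    have h : IntegrableOn (fun x => ‖u x‖ ^ 4 - 2 * (M / R ^ 2) * ‖u x‖ ^ 2) (QR R) :=
      h₄.sub (h₂.const_mul _)
    simp_rw [hpt]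
    rw [integral_add h hc, integral_sub h₄ (h₂.const_mul _),
      integral_const_mul, setIntegral_const, volume_real_QR hR, smul_eq_mul]
  have hnn : 0 ≤ ∫ x in QR R, (‖u x‖ ^ 2 - M / R ^ 2) ^ 2 :=
    integral_nonneg fun x => sq_nonneg _
  have hdiv : (M / R) ^ 2 ≤ P := by
    rw [hexp] at hnn
    have : 2 * (M / R ^ 2) * M - R ^ 2 * (M / R ^ 2) ^ 2 = (M / R) ^ 2 := by
      field_simp; ring
    linarith
  have := Real.le_sqrt_of_sq_le hdiv
  rwa [div_le_iff₀ hR, mul_comm] at this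

/-- The quotients defining `m^N(b,R)` are bounded below by `-R`. -/
lemma neg_le_Elin_div_sqrt {v : ℝ × ℝ → ℂ} {b R : ℝ} (hb : 0 < b) (hR : 0 < R)
    (hv : NeumannClass v R) :
    -R ≤ Elin v b R / Real.sqrt (∫ x in QR R, ‖v x‖ ^ 4) := by
  have hG : 0 ≤ ∫ x in QR R, magGradSq v x :=
    integral_nonneg fun x => by unfold magGradSq; positivity
  have hM := hv.integral_norm_sq_le hR
  have hE := hv.Elin_eq hR b
  rcases (Real.sqrt_nonneg (∫ x in QR R, ‖v x‖ ^ 4)).eq_or_lt with h | h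
  · rw [← h, div_zero]; linarith
  · rw [le_div_iff₀ h]
    have := mul_nonneg hb.le hG
    linarith

lemma mN_le {v : ℝ × ℝ → ℂ} {b R : ℝ} (hb : 0 < b) (hR : 0 < R) (hv : NeumannClass v R)
    (hv0 : v ≠ 0) : mN b R ≤ Elin v b R / Real.sqrt (∫ x in QR R, ‖v x‖ ^ 4) := by
  refine csInf_le ⟨-R, ?_⟩ ⟨v, hv, hv0, rfl⟩
  rintro m ⟨w, hw, -, rfl⟩
  exact neg_le_Elin_div_sqrt hb hR hw

/-- The component `ū (D_v u − i a u)` of the complex magnetic current, for a field `D` of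
derivatives of `u` and a component `a` of the vector potential. -/
def magCurrent (u : ℝ × ℝ → ℂ) (D : ℝ × ℝ → ℝ × ℝ →L[ℝ] ℂ) (v : ℝ × ℝ) (a : ℝ × ℝ → ℝ)
    (x : ℝ × ℝ) : ℂ :=
  (starRingEnd ℂ) (u x) * (D x v - Complex.I * (a x : ℂ) * u x)

/-- At a boundary point, the condition on the total derivative (which may take its default value
there) already forces the one-sided magnetic current to vanish. -/
lemma magCurrent_fderivWithin_eq_zero {u : ℝ × ℝ → ℂ} {s : Set (ℝ × ℝ)} {x v : ℝ × ℝ}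
    {a : ℝ × ℝ → ℝ} (hs : UniqueDiffWithinAt ℝ s x) (ha : a x ≠ 0)
    (h : fderiv ℝ u x v - Complex.I * (a x : ℂ) * u x = 0) :
    magCurrent u (fderivWithin ℝ u s) v a x = 0 := by
  unfold magCurrent
  by_cases hd : DifferentiableAt ℝ u x
  · rw [hd.fderivWithin hs, h, mul_zero]
  · rw [fderiv_zero_of_not_differentiableAt hd] at h
    have : u x = 0 := by simpa [ha] using h
    simp [this]

lemma continuousOn_magCurrent {u : ℝ × ℝ → ℂ} {R : ℝ} (hR : 0 < R) (hu : NeumannClass u R)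
    (v : ℝ × ℝ) {a : ℝ × ℝ → ℝ} (ha : Continuous a) :
    ContinuousOn (magCurrent u (fderivWithin ℝ u (closure (QR R))) v a) (closure (QR R)) := by
  have h₁ := hu.continuousOn_fderivWithin_apply hR v
  have h₀ := hu.continuousOn
  have hA : ContinuousOn (fun x => (a x : ℂ)) (closure (QR R)) :=
    (Complex.continuous_ofReal.comp ha).continuousOn
  unfold magCurrent
  exact (Complex.continuous_conj.comp_continuousOn h₀).mul
    (h₁.sub ((continuousOn_const.mul hA).mul h₀))

/-- Differentiability of the magnetic current, and its derivative in the direction `v` when the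
potential component is constant in that direction. -/
lemma hasFDerivAt_magCurrent {u : ℝ × ℝ → ℂ} {x v : ℝ × ℝ} {a : ℝ × ℝ → ℝ}
    (hu : ContDiffAt ℝ 2 u x) (ha : DifferentiableAt ℝ a x) (hav : fderiv ℝ a x v = 0) :
    HasFDerivAt (magCurrent u (fderiv ℝ u) v a)
      (fderiv ℝ (magCurrent u (fderiv ℝ u) v a) x) x ∧
    fderiv ℝ (magCurrent u (fderiv ℝ u) v a) x v =
      ((‖fderiv ℝ u x v - Complex.I * (a x : ℂ) * u x‖ ^ 2 : ℝ) : ℂ) +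
      (starRingEnd ℂ) (u x) * (fderiv ℝ (fun y => fderiv ℝ u y v) x v -
        2 * Complex.I * ((a x : ℂ) * fderiv ℝ u x v) - (a x : ℂ) ^ 2 * u x) := by
  have hu₁ : HasFDerivAt u (fderiv ℝ u x) x := (hu.differentiableAt (by norm_num)).hasFDerivAt
  have hdu : DifferentiableAt ℝ (fun y => fderiv ℝ u y v) x :=
    ((hu.fderiv_right (m := 1) (by norm_num)).differentiableAt (by norm_num)).clm_apply
      (differentiableAt_const v)
  have hconj : HasFDerivAt (fun y => (starRingEnd ℂ) (u y))
      ((Complex.conjCLE : ℂ →L[ℝ] ℂ).comp (fderiv ℝ u x)) x :=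
    (Complex.conjCLE : ℂ →L[ℝ] ℂ).hasFDerivAt.comp x hu₁
  have hofReal : HasFDerivAt (fun y => (a y : ℂ)) (Complex.ofRealCLM.comp (fderiv ℝ a x)) x :=
    Complex.ofRealCLM.hasFDerivAt.comp x ha.hasFDerivAt
  have hF : HasFDerivAt (magCurrent u (fderiv ℝ u) v a) _ x :=
    hconj.mul (hdu.hasFDerivAt.sub ((hofReal.const_mul Complex.I).mul hu₁))
  refine ⟨hF.differentiableAt.hasFDerivAt, ?_⟩
  rw [hF.fderiv, Complex.ofReal_pow, ← Complex.mul_conj']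
  simp [hav]
  linear_combination (starRingEnd ℂ) (u x) * (a x : ℂ) ^ 2 * u x * Complex.I_sq

lemma differentiableAt_A0_fst {x : ℝ × ℝ} : DifferentiableAt ℝ (fun y => (A0 y).1) x := by
  unfold A0; fun_prop

lemma differentiableAt_A0_snd {x : ℝ × ℝ} : DifferentiableAt ℝ (fun y => (A0 y).2) x := by
  unfold A0; fun_prop

lemma fderiv_A0_fst {x : ℝ × ℝ} : fderiv ℝ (fun y => (A0 y).1) x (1, 0) = 0 := by
  have h : HasFDerivAt (fun y => (A0 y).1) ((-1 / 2 : ℝ) • ContinuousLinearMap.snd ℝ ℝ ℝ) x := by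
    convert ((-1 / 2 : ℝ) • ContinuousLinearMap.snd ℝ ℝ ℝ).hasFDerivAt using 2 with y
    simp [A0]; ring
  simp [h.fderiv]

lemma fderiv_A0_snd {x : ℝ × ℝ} : fderiv ℝ (fun y => (A0 y).2) x (0, 1) = 0 := by
  have h : HasFDerivAt (fun y => (A0 y).2) ((1 / 2 : ℝ) • ContinuousLinearMap.fst ℝ ℝ ℝ) x := by
    convert ((1 / 2 : ℝ) • ContinuousLinearMap.fst ℝ ℝ ℝ).hasFDerivAt using 2 with y
    simp [A0]; ring
  simp [h.fderiv]

/-- The normal component of the magnetic current vanishes on the four edges of the square, away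
from the corners and the midpoints. -/
lemma magCurrent_boundary {R : ℝ} (hR : 0 < R) {u : ℝ × ℝ → ℂ} (hbc : MagNeumannBC u R) :
    (∀ t ∈ Set.Ioo (-R / 2) (R / 2), t ≠ 0 → magCurrent u (fderivWithin ℝ u (closure (QR R)))
      (1, 0) (fun y => (A0 y).1) (R / 2, t) = 0) ∧
    (∀ t ∈ Set.Ioo (-R / 2) (R / 2), t ≠ 0 → magCurrent u (fderivWithin ℝ u (closure (QR R)))
      (1, 0) (fun y => (A0 y).1) (-R / 2, t) = 0) ∧
    (∀ t ∈ Set.Ioo (-R / 2) (R / 2), t ≠ 0 → magCurrent u (fderivWithin ℝ u (closure (QR R)))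
      (0, 1) (fun y => (A0 y).2) (t, R / 2) = 0) ∧
    (∀ t ∈ Set.Ioo (-R / 2) (R / 2), t ≠ 0 → magCurrent u (fderivWithin ℝ u (closure (QR R)))
      (0, 1) (fun y => (A0 y).2) (t, -R / 2) = 0) := by
  have hne : -R / 2 ≠ R / 2 := by intro h; linarith
  have hfr : ∀ x : ℝ × ℝ, x ∈ closure (QR R) → x ∉ QR R → x ∈ frontier (QR R) := fun x h h' => by
    rw [frontier, (isOpen_QR R).interior_eq]; exact ⟨h, h'⟩
  have hmem : ∀ s t : ℝ, s ∈ Set.Icc (-R / 2) (R / 2) → t ∈ Set.Icc (-R / 2) (R / 2) →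
      (s, t) ∈ closure (QR R) := fun s t hs ht => by
    rw [closure_QR hR, ← Set.Icc_prod_Icc]; exact ⟨hs, ht⟩
  have hr : R / 2 ∈ Set.Icc (-R / 2) (R / 2) := ⟨by linarith, le_rfl⟩
  have hl : -R / 2 ∈ Set.Icc (-R / 2) (R / 2) := ⟨le_rfl, by linarith⟩
  have hud := uniqueDiffOn_closure_QR hR
  refine ⟨fun t ht h0 => ?_, fun t ht h0 => ?_, fun t ht h0 => ?_, fun t ht h0 => ?_⟩
  · have hx := hmem _ _ hr (Set.Ioo_subset_Icc_self ht)
    refine magCurrent_fderivWithin_eq_zero (hud _ hx) (by simpa [A0] using h0) ?_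
    have h := hbc _ (hfr _ hx (by simp [QR])) (by simp [IsCornerPt, ht.1.ne', ht.2.ne])
    simpa [nuSq, ht.1.ne', ht.2.ne] using h
  · have hx := hmem _ _ hl (Set.Ioo_subset_Icc_self ht)
    refine magCurrent_fderivWithin_eq_zero (hud _ hx) (by simpa [A0] using h0) ?_
    have h := hbc _ (hfr _ hx (by simp [QR])) (by simp [IsCornerPt, ht.1.ne', ht.2.ne])
    simp only [nuSq, if_neg hne, if_neg ht.1.ne', if_neg ht.2.ne, if_true] at h
    push_cast at h
    linear_combination -h
  · have hx := hmem _ _ (Set.Ioo_subset_Icc_self ht) hr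
    refine magCurrent_fderivWithin_eq_zero (hud _ hx) (by simpa [A0] using h0) ?_
    have h := hbc _ (hfr _ hx (by simp [QR])) (by simp [IsCornerPt, ht.1.ne', ht.2.ne])
    simpa [nuSq, ht.1.ne', ht.2.ne] using h
  · have hx := hmem _ _ (Set.Ioo_subset_Icc_self ht) hl
    refine magCurrent_fderivWithin_eq_zero (hud _ hx) (by simpa [A0] using h0) ?_
    have h := hbc _ (hfr _ hx (by simp [QR])) (by simp [IsCornerPt, ht.1.ne', ht.2.ne])
    simp only [nuSq, if_neg hne, if_neg ht.1.ne', if_neg ht.2.ne, if_true] at h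
    push_cast at h
    linear_combination -h

/-- A function vanishing on an open interval except possibly at `0` has zero integral. -/
lemma integral_edge_eq_zero {c d : ℝ} {h : ℝ → ℂ} (hcd : c ≤ d)
    (hh : ∀ t ∈ Set.Ioo c d, t ≠ 0 → h t = 0) : ∫ t in c..d, h t = 0 := by
  refine intervalIntegral.integral_zero_ae ?_
  filter_upwards [Measure.ae_ne volume (0 : ℝ), Measure.ae_ne volume d] with t h0 hd ht
  rw [Set.uIoc_of_le hcd] at ht
  exact hh t ⟨ht.1, lt_of_le_of_ne ht.2 hd⟩ h0

/-- The divergence of the magnetic current is `|(∇−iA₀)u|² + ū (∇−iA₀)²u`. -/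
lemma magCurrent_divergence {u : ℝ × ℝ → ℂ} {x : ℝ × ℝ} (hu : ContDiffAt ℝ 2 u x) :
    fderiv ℝ (magCurrent u (fderiv ℝ u) (1, 0) fun y => (A0 y).1) x (1, 0) +
      fderiv ℝ (magCurrent u (fderiv ℝ u) (0, 1) fun y => (A0 y).2) x (0, 1) =
    (magGradSq u x : ℂ) + (starRingEnd ℂ) (u x) * magLap u x := by
  rw [(hasFDerivAt_magCurrent hu differentiableAt_A0_fst fderiv_A0_fst).2,
    (hasFDerivAt_magCurrent hu differentiableAt_A0_snd fderiv_A0_snd).2, magGradSq, magLap]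
  push_cast
  ring

/-- Testing the Euler–Lagrange equation against `u`: a solution with magnetic Neumann boundary
condition satisfies `E_lin(u;b,R) = -∫_{Q_R} |u|⁴`. -/
lemma Elin_eq_neg_integral {b R : ℝ} (hb : 0 < b) (hR : 0 < R) {u : ℝ × ℝ → ℂ}
    (hu : NeumannClass u R) (hu2 : ContDiffOn ℝ 2 u (QR R))
    (hEL : ∀ x ∈ QR R, -(b : ℂ) * magLap u x = ((1 - ‖u x‖ ^ 2 : ℝ) : ℂ) * u x)
    (hbc : MagNeumannBC u R) :
    Elin u b R = -∫ x in QR R, ‖u x‖ ^ 4 := by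
  set f := magCurrent u (fderivWithin ℝ u (closure (QR R))) (1, 0) fun y => (A0 y).1
  set g := magCurrent u (fderivWithin ℝ u (closure (QR R))) (0, 1) fun y => (A0 y).2
  have hlocal : ∀ x ∈ QR R, ∀ (v : ℝ × ℝ) (a : ℝ × ℝ → ℝ),
      magCurrent u (fderivWithin ℝ u (closure (QR R))) v a =ᶠ[nhds x]
        magCurrent u (fderiv ℝ u) v a := by
    intro x hx v a
    filter_upwards [(isOpen_QR R).mem_nhds hx] with y hy
    simp only [magCurrent, fderivWithin_closure_QR u hy]
  have hC2 : ∀ x ∈ QR R, ContDiffAt ℝ 2 u x := fun x hx =>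
    hu2.contDiffAt ((isOpen_QR R).mem_nhds hx)
  have hdf : ∀ x ∈ QR R, HasFDerivAt f (fderiv ℝ f x) x := fun x hx =>
    ((hlocal x hx _ _).differentiableAt_iff.2 (hasFDerivAt_magCurrent (hC2 x hx)
      differentiableAt_A0_fst fderiv_A0_fst).1.differentiableAt).hasFDerivAt
  have hdg : ∀ x ∈ QR R, HasFDerivAt g (fderiv ℝ g x) x := fun x hx =>
    ((hlocal x hx _ _).differentiableAt_iff.2 (hasFDerivAt_magCurrent (hC2 x hx)
      differentiableAt_A0_snd fderiv_A0_snd).1.differentiableAt).hasFDerivAt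
  have hdiv : ∀ x ∈ QR R, fderiv ℝ f x (1, 0) + fderiv ℝ g x (0, 1) =
      ((magGradSq u x - b⁻¹ * (‖u x‖ ^ 2 - ‖u x‖ ^ 4) : ℝ) : ℂ) := by
    intro x hx
    rw [(hlocal x hx _ _).fderiv_eq, (hlocal x hx _ _).fderiv_eq, magCurrent_divergence (hC2 x hx)]
    have hb' : (b : ℂ) ≠ 0 := by exact_mod_cast hb.ne'
    have hsq : (starRingEnd ℂ) (u x) * u x = (‖u x‖ : ℂ) ^ 2 := Complex.conj_mul' _
    have h := hEL x hx
    push_cast at h ⊢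
    field_simp
    linear_combination (-(starRingEnd ℂ) (u x)) * h - (1 - (‖u x‖ : ℂ) ^ 2) * hsq
  have hpot : IntegrableOn (fun x => b⁻¹ * (‖u x‖ ^ 2 - ‖u x‖ ^ 4)) (QR R) :=
    ((hu.integrableOn_norm_pow hR 2).sub (hu.integrableOn_norm_pow hR 4)).const_mul _
  have hdivInt : IntegrableOn (fun x => magGradSq u x - b⁻¹ * (‖u x‖ ^ 2 - ‖u x‖ ^ 4)) (QR R) :=
    (hu.integrableOn_magGradSq hR).sub hpot
  have hintC : IntegrableOn (fun x => fderiv ℝ f x (1, 0) + fderiv ℝ g x (0, 1)) (QR R) :=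
    IntegrableOn.congr_fun hdivInt.ofReal (fun x hx => (hdiv x hx).symm) (isOpen_QR R).measurableSet
  have hthm := integral_divergence_prod_Icc_of_hasFDerivAt_of_le f g (fderiv ℝ f) (fderiv ℝ g)
    (-R / 2, -R / 2) (R / 2, R / 2) ⟨by simp; linarith, by simp; linarith⟩
    (by rw [← closure_QR hR]; exact continuousOn_magCurrent hR hu _ continuous_A0.fst)
    (by rw [← closure_QR hR]; exact continuousOn_magCurrent hR hu _ continuous_A0.snd)
    hdf hdg
    (by rw [← closure_QR hR]; exact hintC.congr_set_ae (QR_ae_eq_closure hR).symm)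
  have hle : -R / 2 ≤ R / 2 := by linarith
  obtain ⟨hfr, hfl, hgt, hgb⟩ := magCurrent_boundary hR hbc
  rw [integral_edge_eq_zero hle hfr, integral_edge_eq_zero hle hfl, integral_edge_eq_zero hle hgt,
    integral_edge_eq_zero hle hgb, ← closure_QR hR, ← setIntegral_congr_set (QR_ae_eq_closure hR),
    setIntegral_congr_fun (isOpen_QR R).measurableSet hdiv, integral_complex_ofReal] at hthm
  have hzero : ∫ x in QR R, (magGradSq u x - b⁻¹ * (‖u x‖ ^ 2 - ‖u x‖ ^ 4)) = 0 := by
    have : ((∫ x in QR R, (magGradSq u x - b⁻¹ * (‖u x‖ ^ 2 - ‖u x‖ ^ 4)) : ℝ) : ℂ) = 0 := by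
      simpa using hthm
    exact_mod_cast this
  rw [integral_sub (hu.integrableOn_magGradSq hR) hpot, integral_const_mul,
    integral_sub (hu.integrableOn_norm_pow hR 2) (hu.integrableOn_norm_pow hR 4)] at hzero
  rw [hu.Elin_eq hR b]
  field_simp at hzero
  linarith

/-- Upper bound of Theorem 1.1, Neumann case, quantitative per-`R` form. -/
theorem neumann_upper_bound (b R E C₀ : ℝ) (hb : 0 < b) (hR : 0 < R) (hE : E < 0)
    (hC₀ : 0 ≤ C₀) (hRC : R > C₀ / (-E))
    (u : ℝ × ℝ → ℂ) (hu : NeumannClass u R) (hu2 : ContDiffOn ℝ 2 u (QR R))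
    (hEL : ∀ x ∈ QR R, -(b : ℂ) * magLap u x = ((1 - ‖u x‖ ^ 2 : ℝ) : ℂ) * u x)
    (hbc : MagNeumannBC u R)
    (hmin : Eblk u b R ≤ R ^ 2 * E + C₀ * R) :
    (0 < ∫ x in QR R, ‖u x‖ ^ 4) ∧
    Elin u b R ≤ (-R * Real.sqrt (-2 * E) + 2 * C₀ * (Real.sqrt (-2 * E))⁻¹) *
      Real.sqrt (∫ x in QR R, ‖u x‖ ^ 4) ∧
    mN b R ≤ -R * Real.sqrt (-2 * E) + 2 * C₀ * (Real.sqrt (-2 * E))⁻¹ := by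
  have hlin := Elin_eq_neg_integral hb hR hu hu2 hEL hbc
  have hblk := hu.Eblk_eq hR b
  have hs : 0 < Real.sqrt (-2 * E) := Real.sqrt_pos.2 (by linarith)
  have hs2 : Real.sqrt (-2 * E) ^ 2 = -2 * E := Real.sq_sqrt (by linarith)
  have hmN : u ≠ 0 → mN b R ≤ _ := mN_le hb hR hu
  set s := Real.sqrt (-2 * E)
  set P := ∫ x in QR R, ‖u x‖ ^ 4 with hP
  have hRE : C₀ < R * -E := by rwa [gt_iff_lt, div_lt_iff₀ (by linarith)] at hRC
  -- `k` is the positive constant of the claimed bound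
  set k := R * s - 2 * C₀ * s⁻¹ with hk
  have hks : R * s * k = R ^ 2 * s ^ 2 - 2 * C₀ * R := by
    rw [hk]; field_simp
  have hkpos : 0 < k := by
    refine pos_of_mul_pos_right (a := R * s) ?_ (by positivity)
    rw [hks, hs2]; nlinarith
  have hPk : R * s * k ≤ P := by rw [hks, hs2]; linarith
  have hPpos : 0 < P := lt_of_lt_of_le (by positivity) hPk
  have hkP : k ≤ Real.sqrt P := by
    refine Real.le_sqrt_of_sq_le (le_trans ?_ hPk)
    have : k ≤ R * s := by
      have : 0 ≤ 2 * C₀ * s⁻¹ := by positivity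
      linarith
    nlinarith
  have hsP : 0 < Real.sqrt P := Real.sqrt_pos.2 hPpos
  have hbound : Elin u b R ≤ (-R * s + 2 * C₀ * s⁻¹) * Real.sqrt P := by
    rw [hlin]
    have := mul_le_mul_of_nonneg_right hkP hsP.le
    rw [Real.mul_self_sqrt hPpos.le] at this
    linarith
  have hu0 : u ≠ 0 := by
    rintro rfl
    simp [hP] at hPpos
  exact ⟨hPpos, hbound, (hmN hu0).trans ((div_le_iff₀ hsP).2 hbound)⟩
end
end
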